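/- arXiv:1112.1580 — 5 statements merged into one kernel-verified Lean document; each statement's English description precedes it below -/
import Mathlib

section
/- Let p be an odd prime and let k be an algebraically closed field of characteristic p. Let G be a finite group, H ⊆ G a subgroup of index 2, and ρ : G → GL₂(k) an injective group homomorphism such that the associated 2-dimensional representation of G on k² is irreducible. Assume (1) there exists an element c ∈ G \ H with c² = 1, and (2) Tr ρ(hc) = 0 for all h ∈ H. Then the restriction of ρ to H is reducible, i.e. k² is not a simple k[H]-module. -/
/-- Two matrices orthogonal (with their products) to a trace-zero involution commute. -/
theorem toric_commute_aux {k : Type*} [Field k] (h2 : (2 : k) ≠ 0)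
    (A B C : Matrix (Fin 2) (Fin 2) k) (hC : C * C = 1) (tC : C.trace = 0)
    (tA : (A * C).trace = 0) (tB : (B * C).trace = 0)
    (tAB : (A * B * C).trace = 0) (tBA : (B * A * C).trace = 0) : A * B = B * A := by
  have e := congrFun (congrFun hC 0) 0
  simp only [Matrix.trace_fin_two, Matrix.mul_apply, Fin.sum_univ_two, Matrix.one_apply_eq]
    at e tC tA tB tAB tBA
  have hA := Matrix.eta_fin_two A
  generalize A 0 0 = a1 at *
  generalize A 0 1 = a2 at *
  generalize A 1 0 = a3 at *
  generalize A 1 1 = a4 at *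
  have hB := Matrix.eta_fin_two B
  generalize B 0 0 = b1 at *
  generalize B 0 1 = b2 at *
  generalize B 1 0 = b3 at *
  generalize B 1 1 = b4 at *
  generalize C 0 0 = x at *
  generalize C 0 1 = y at *
  generalize C 1 0 = z at *
  generalize C 1 1 = w at *
  obtain rfl : w = -x := by linear_combination tC
  have p1 : (a2*b3-a3*b2)*z = (a3*(b1-b4)-(a1-a4)*b3)*x := by
    linear_combination b3 * tA - a3 * tB
  have p2 : (a2*b3-a3*b2)*y = ((a1-a4)*b2-a2*(b1-b4))*x := by
    linear_combination a2 * tB - b2 * tA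
  have p3 : z*((a1-a4)*b2-a2*(b1-b4)) = y*(a3*(b1-b4)-(a1-a4)*b3) := by
    linear_combination (a1-a4) * tB - (b1-b4) * tA
  have q : x*(a2*b3-a3*b2) + y*(a3*(b1-b4)-(a1-a4)*b3) = 0 := by
    apply mul_left_cancel₀ h2
    linear_combination tAB - tBA - p3
  have r1 : a2*b3-a3*b2 = 0 := by
    linear_combination x * q + y * p1 - (a2*b3-a3*b2) * e
  have r2 : (a1-a4)*b2-a2*(b1-b4) = 0 := by
    linear_combination y * q - x * p2 + y * p3 - ((a1-a4)*b2-a2*(b1-b4)) * e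
  have r3 : a3*(b1-b4)-(a1-a4)*b3 = 0 := by
    linear_combination z * q - x * p1 - (a3*(b1-b4)-(a1-a4)*b3) * e
  rw [hA, hB]
  ext i j
  fin_cases i <;> fin_cases j <;> simp [Matrix.mul_apply, Fin.sum_univ_two]
  · linear_combination r1
  · linear_combination r2
  · linear_combination r3
  · linear_combination -r1

/-- Lemma 7.3: if `ρ : G → GL₂(k)` is a faithful irreducible representation over an
algebraically closed field `k` of odd characteristic `p`, `H ≤ G` has index 2, there is an
order-two element `c ∉ H`, and `Tr ρ(hc) = 0` for all `h ∈ H`, then `ρ|_H` is reducible. -/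
theorem toric_reducible_restriction
    (p : ℕ) (hp : p.Prime) (hodd : Odd p)
    (k : Type*) [Field k] [IsAlgClosed k] [CharP k p]
    (G : Type*) [Group G] [Finite G]
    (H : Subgroup G) (hH : H.index = 2)
    (ρ : G →* GL (Fin 2) k) (hinj : Function.Injective ρ)
    (hirr : ∀ W : Submodule k (Fin 2 → k),
      (∀ g : G, ∀ v ∈ W, Matrix.mulVec (ρ g : Matrix (Fin 2) (Fin 2) k) v ∈ W) →
      W = ⊥ ∨ W = ⊤)
    (c : G) (hcH : c ∉ H) (hc2 : c ^ 2 = 1)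
    (htr : ∀ h ∈ H, Matrix.trace ((ρ (h * c) : Matrix (Fin 2) (Fin 2) k)) = 0) :
    ∃ W : Submodule k (Fin 2 → k), W ≠ ⊥ ∧ W ≠ ⊤ ∧
      ∀ h ∈ H, ∀ v ∈ W, Matrix.mulVec (ρ h : Matrix (Fin 2) (Fin 2) k) v ∈ W := by
  have h2 : (2 : k) ≠ 0 := by
    intro h
    have h' : ((2 : ℕ) : k) = 0 := by exact_mod_cast h
    rw [CharP.cast_eq_zero_iff k p] at h'
    have := (Nat.prime_dvd_prime_iff_eq hp Nat.prime_two).1 h'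
    subst this
    exact absurd hodd (by decide)
  have comm : ∀ g ∈ H, ∀ h ∈ H, (ρ g : Matrix (Fin 2) (Fin 2) k) * ρ h = ρ h * ρ g := by
    intro g hg h hh
    refine toric_commute_aux h2 _ _ (ρ c : Matrix (Fin 2) (Fin 2) k) ?_ ?_ ?_ ?_ ?_ ?_
    · rw [← Units.val_mul, ← map_mul, ← pow_two, hc2, map_one, Units.val_one]
    · simpa using htr 1 H.one_mem
    · simpa using htr g hg
    · simpa using htr h hh
    · simpa using htr (g * h) (H.mul_mem hg hh)
    · simpa using htr (h * g) (H.mul_mem hh hg)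
  by_cases hs : ∀ h ∈ H, ∃ a : k, (ρ h : Matrix (Fin 2) (Fin 2) k) = a • 1
  · refine ⟨LinearMap.ker (LinearMap.proj (R := k) (φ := fun _ : Fin 2 => k) 0), ?_, ?_, ?_⟩
    · intro hb
      have : (![0, 1] : Fin 2 → k) ∈ (⊥ : Submodule k (Fin 2 → k)) := by
        rw [← hb]; simp
      rw [Submodule.mem_bot] at this
      simpa using congrFun this 1
    · intro hb
      have : (![1, 0] : Fin 2 → k) ∈ (⊤ : Submodule k (Fin 2 → k)) := trivial
      rw [← hb] at this
      simp at this
    · intro h hh v hv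
      obtain ⟨a, ha⟩ := hs h hh
      rw [ha, Matrix.smul_mulVec, Matrix.one_mulVec]
      exact Submodule.smul_mem _ _ hv
  · push Not at hs
    obtain ⟨g, hg, hns⟩ := hs
    obtain ⟨μ, hμ⟩ := Module.End.exists_eigenvalue
      (Matrix.toLin' (ρ g : Matrix (Fin 2) (Fin 2) k))
    refine ⟨Module.End.eigenspace (Matrix.toLin' (ρ g : Matrix (Fin 2) (Fin 2) k)) μ, hμ, ?_, ?_⟩
    · intro ht
      apply hns μ
      apply Matrix.toLin'.injective
      ext1 i
      ext1
      have : (Pi.single i 1 : Fin 2 → k) ∈ (⊤ : Submodule k (Fin 2 → k)) := trivial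
      rw [← ht, Module.End.mem_eigenspace_iff] at this
      simpa using this
    · intro h hh v hv
      rw [Module.End.mem_eigenspace_iff, Matrix.toLin'_apply] at hv ⊢
      rw [Matrix.mulVec_mulVec, comm g hg h hh, ← Matrix.mulVec_mulVec, hv, Matrix.mulVec_smul]
end

section
/- Let k be an algebraically closed field and G a finite group whose order is invertible in k (i.e. char k does not divide |G|). Let H ⊆ G be a subgroup of index 2 and let ρ be a finite-dimensional irreducible representation of G over k such that Tr ρ(g) = 0 for every g ∈ G \ H. Then the restriction of ρ to H is not irreducible. -/
lemma isIrreducible_of_invariant {k G V : Type*} [Field k] [Group G] [AddCommGroup V] [Module k V]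
    [Nontrivial V] (ρ : Representation k G V)
    (h : ∀ W : Submodule k V, (∀ g : G, ∀ v ∈ W, ρ g v ∈ W) → W = ⊥ ∨ W = ⊤) :
    ρ.IsIrreducible := by
  have hne : (⊥ : Subrepresentation ρ) ≠ ⊤ := fun e =>
    bot_ne_top (α := Submodule k V) (congrArg Subrepresentation.toSubmodule e)
  exact
    { exists_pair_ne := ⟨⊥, ⊤, hne⟩
      eq_bot_or_eq_top := fun W => by
        rcases h W.toSubmodule (fun g v hv => W.apply_mem_toSubmodule g hv) with h | h
        · exact Or.inl (Subrepresentation.toSubmodule_injective h)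
        · exact Or.inr (Subrepresentation.toSubmodule_injective h) }

lemma sum_char_of_irreducible {k G V : Type*} [Field k] [IsAlgClosed k] [Group G] [Fintype G]
    [AddCommGroup V] [Module k V] [FiniteDimensional k V] (hc : (Nat.card G : k) ≠ 0)
    (ρ : Representation k G V) [ρ.IsIrreducible] :
    ∑ g : G, ρ.character g * ρ.character g⁻¹ = (Nat.card G : k) := by
  classical
  have := invertibleOfNonzero hc
  have h := Representation.char_orthonormal ρ ρ
  rw [if_pos ⟨Representation.Equiv.refl ρ⟩] at h
  field_simp at h
  simpa using h

/-- Semisimple branch of Lemma 7.3: if `char k ∤ |G|`, `ρ` is an irreducible representation of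
the finite group `G` over the algebraically closed field `k`, `H ≤ G` has index 2, and the
character of `ρ` vanishes off `H`, then `ρ|_H` is not irreducible. -/
theorem restriction_not_irreducible_of_trace_vanishing
    (k : Type*) [Field k] [IsAlgClosed k]
    (G : Type*) [Group G] [Fintype G]
    (hcard : (Fintype.card G : k) ≠ 0)
    (H : Subgroup G) (hH : H.index = 2)
    (V : Type*) [AddCommGroup V] [Module k V] [FiniteDimensional k V]
    (ρ : Representation k G V)
    (hV : Nontrivial V)
    (hirr : ∀ W : Submodule k V, (∀ g : G, ∀ v ∈ W, ρ g v ∈ W) → W = ⊥ ∨ W = ⊤)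
    (htr : ∀ g : G, g ∉ H → LinearMap.trace k V (ρ g) = 0) :
    ∃ W : Submodule k V, W ≠ ⊥ ∧ W ≠ ⊤ ∧ ∀ h ∈ H, ∀ v ∈ W, ρ h v ∈ W := by
  classical
  by_contra hcon
  have hG : (Nat.card G : k) ≠ 0 := by rwa [Nat.card_eq_fintype_card]
  have hmul : (Nat.card G : k) = Nat.card H * 2 := by
    rw [← H.card_mul_index, hH]; push_cast; rfl
  have hHc : (Nat.card H : k) ≠ 0 := fun e => hG (by rw [hmul, e, zero_mul])
  let σ : Representation k H V := ρ.comp H.subtype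
  have hρ : ρ.IsIrreducible := isIrreducible_of_invariant ρ hirr
  have hσ : σ.IsIrreducible := isIrreducible_of_invariant σ fun W hW => by
    by_contra hW2
    rw [not_or] at hW2
    exact hcon ⟨W, hW2.1, hW2.2, fun h hh v hv => hW ⟨h, hh⟩ v hv⟩
  have h1 := sum_char_of_irreducible hG ρ
  have h2 := sum_char_of_irreducible hHc σ
  have h3 : ∑ g : G, ρ.character g * ρ.character g⁻¹ =
      ∑ h : H, σ.character h * σ.character h⁻¹ := by
    symm
    refine Finset.sum_of_injOn (fun h : H => (h : G)) Subtype.val_injective.injOn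
      (by simp) ?_ (fun h _ => rfl)
    intro g _ hg
    have : g ∉ H := fun hg' => hg ⟨⟨g, hg'⟩, by simp, rfl⟩
    simp [Representation.character, htr g this]
  rw [h1, h2, hmul] at h3
  exact hHc (by linear_combination h3)
end

section
/- Let p be a prime and k a field of characteristic p. Let A ∈ GL₂(k) be a matrix of p-power order, i.e. A^(p^n) = 1 for some n ≥ 0. Then (A − 1)² = 0, Tr A = 2 and det A = 1. If moreover Tr(A · J₀) = 0, where J₀ = !![0,1; 1,0], then there exists x ∈ k such that either A = 1 + x · b₁ or A = 1 + x · b₂, where b₁ = !![1,1; −1,−1] and b₂ = !![1,−1; 1,−1]. -/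
/-- Classification of elements of `p`-power order in `GL₂(k)`, `char k = p`: they are unipotent
with `(A - 1)² = 0`, `Tr A = 2`, `det A = 1`; and if moreover `Tr(A·J₀) = 0` with
`J₀ = !![0,1;1,0]`, then `A = 1 + x·b₁` or `A = 1 + x·b₂` for some `x ∈ k`, where
`b₁ = !![1,1;-1,-1]` and `b₂ = !![1,-1;1,-1]`. -/
theorem unipotent_classification
    (p : ℕ) (hp : p.Prime) (k : Type*) [Field k] [CharP k p]
    (A : GL (Fin 2) k) (n : ℕ) (hA : A ^ (p ^ n) = 1) :
    ((A : Matrix (Fin 2) (Fin 2) k) - 1) ^ 2 = 0 ∧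
    Matrix.trace (A : Matrix (Fin 2) (Fin 2) k) = 2 ∧
    Matrix.det (A : Matrix (Fin 2) (Fin 2) k) = 1 ∧
    (Matrix.trace ((A : Matrix (Fin 2) (Fin 2) k) * !![0, 1; 1, 0]) = 0 →
      ∃ x : k, (A : Matrix (Fin 2) (Fin 2) k) = 1 + x • !![(1 : k), 1; -1, -1] ∨
        (A : Matrix (Fin 2) (Fin 2) k) = 1 + x • !![(1 : k), -1; 1, -1]) := by
  have : Fact p.Prime := ⟨hp⟩
  have hM : (A : Matrix (Fin 2) (Fin 2) k) ^ (p ^ n) = 1 := by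
    rw [← Units.val_pow_eq_pow_val, hA, Units.val_one]
  generalize (A : Matrix (Fin 2) (Fin 2) k) = M at hM
  have hN : (M - 1) ^ (p ^ n) = 0 := by
    rw [sub_pow_char_pow_of_commute _ _ (Commute.one_right M), hM, one_pow, sub_self]
  have hnil : IsNilpotent (M - 1) := ⟨_, hN⟩
  have htr : (M - 1).trace = 0 := (Matrix.isNilpotent_trace_of_isNilpotent hnil).eq_zero
  have hdet : (M - 1).det = 0 := by
    have h : (M - 1).det ^ (p ^ n) = 0 := by
      rw [← Matrix.det_pow, hN, Matrix.det_zero]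
    exact eq_zero_of_pow_eq_zero h
  obtain ⟨N, rfl⟩ : ∃ N, M = 1 + N := ⟨M - 1, by simp⟩
  rw [add_sub_cancel_left] at *
  clear hM hN hnil
  rw [Matrix.eta_fin_two N] at *
  generalize N 0 0 = a at *
  generalize N 0 1 = b at *
  generalize N 1 0 = c at *
  generalize N 1 1 = d at *
  simp only [Matrix.trace_fin_two_of, Matrix.det_fin_two_of] at htr hdet
  obtain rfl : d = -a := by linear_combination htr
  refine ⟨?_, ?_, ?_, ?_⟩
  · ext i j
    fin_cases i <;> fin_cases j <;> simp [pow_two, Matrix.mul_apply, Fin.sum_univ_two] <;>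
      first | linear_combination -hdet | ring
  · simp [Matrix.trace_fin_two, one_add_one_eq_two]
  · simp [Matrix.det_fin_two]; linear_combination hdet
  · intro h
    have h' : b + c = 0 := by
      simpa [Matrix.trace_fin_two, Matrix.mul_apply, Fin.sum_univ_two] using h
    obtain rfl : c = -b := by linear_combination h'
    have h2 : (b - a) * (b + a) = 0 := by linear_combination hdet
    refine ⟨a, ?_⟩
    rcases mul_eq_zero.mp h2 with h3 | h3
    · obtain rfl : b = a := by linear_combination h3
      left; simp
    · obtain rfl : b = -a := by linear_combination h3
      right; simp
end

section
/- Let p be an odd prime and k an algebraically closed field of characteristic p. Let G be a finite group, H ⊆ G a subgroup of index 2, and ρ : G → GL₂(k) an injective group homomorphism. Assume there exists c ∈ G \ H with c² = 1 such that Tr ρ(hc) = 0 for all h ∈ H, and assume p divides |H|. Then any two elements of H of p-power order commute, and H has a unique (hence normal) Sylow p-subgroup. -/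
/-- If `C` is a traceless involution and `M`, `N`, `MN`, `NM` are all trace-orthogonal to `C`,
then `M` and `N` commute. -/
theorem comm_of_trace_zero {k : Type*} [Field k] (h2 : (2 : k) ≠ 0)
    (M N C : Matrix (Fin 2) (Fin 2) k) (hC : C * C = 1) (tC : C.trace = 0)
    (tM : (M * C).trace = 0) (tN : (N * C).trace = 0)
    (tMN : (M * N * C).trace = 0) (tNM : (N * M * C).trace = 0) : M * N = N * M := by
  have hC0 := congrFun (congrFun hC 0) 0
  simp only [Matrix.trace_fin_two, Matrix.mul_apply, Fin.sum_univ_two, Matrix.one_apply_eq]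
    at hC0 tC tM tN tMN tNM
  have hw : C 1 1 = - C 0 0 := by linear_combination tC
  rw [hw] at tM tN tMN tNM
  have key : ∀ a b c d e f g h x y z : k, x * x + y * z = 1 →
      a * x + b * z + (c * y + d * -x) = 0 → e * x + f * z + (g * y + h * -x) = 0 →
      2 * x * (b * g - c * f) + z * ((a - d) * f - b * (e - h))
        + y * (c * (e - h) - g * (a - d)) = 0 →
      b * g - c * f = 0 ∧ (a - d) * f - b * (e - h) = 0 ∧ c * (e - h) - g * (a - d) = 0 := by
    intro a b c d e f g h x y z hx hm hn ht
    refine ⟨?_, ?_, ?_⟩ <;> apply (mul_eq_zero.mp _).resolve_left h2 <;> grind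
  obtain ⟨k1, k2, k3⟩ := key _ _ _ _ _ _ _ _ _ _ _ hC0 tM tN
    (by linear_combination tMN - tNM)
  ext i j
  fin_cases i <;> fin_cases j <;>
    simp only [Matrix.mul_apply, Fin.sum_univ_two, Fin.zero_eta, Fin.mk_one, Fin.isValue]
  · linear_combination k1
  · linear_combination k2
  · linear_combination k3
  · linear_combination -k1

/-- The `p ∣ |H|` branch of the proof of Lemma 7.3: under the trace-vanishing condition,
any two elements of `H` of `p`-power order commute, and `H` has a unique Sylow `p`-subgroup. -/
theorem sylow_structure_of_trace_vanishing
    (p : ℕ) (hp : p.Prime) (hodd : Odd p)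
    (k : Type*) [Field k] [IsAlgClosed k] [CharP k p]
    (G : Type*) [Group G] [Finite G]
    (H : Subgroup G) (hH : H.index = 2)
    (ρ : G →* GL (Fin 2) k) (hinj : Function.Injective ρ)
    (c : G) (hcH : c ∉ H) (hc2 : c ^ 2 = 1)
    (htr : ∀ h ∈ H, Matrix.trace ((ρ (h * c) : Matrix (Fin 2) (Fin 2) k)) = 0)
    (hdvd : p ∣ Nat.card H) :
    (∀ a b : G, a ∈ H → b ∈ H → (∃ m : ℕ, a ^ p ^ m = 1) → (∃ m : ℕ, b ^ p ^ m = 1) →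
      a * b = b * a) ∧
    (∀ P Q : Sylow p H, P = Q) := by
  have h2 : (2 : k) ≠ 0 := by
    intro h
    have h' : ((2 : ℕ) : k) = 0 := by exact_mod_cast h
    rw [CharP.cast_eq_zero_iff k p] at h'
    have := (Nat.prime_dvd_prime_iff_eq hp Nat.prime_two).mp h'
    subst this
    exact absurd hodd (by decide)
  have hcomm : ∀ a b : G, a ∈ H → b ∈ H → a * b = b * a := by
    intro a b ha hb
    apply hinj
    apply Units.ext
    have hC : (ρ c : Matrix (Fin 2) (Fin 2) k) * (ρ c : Matrix (Fin 2) (Fin 2) k) = 1 := by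
      rw [← Units.val_mul, ← map_mul, ← pow_two, hc2, map_one, Units.val_one]
    have t1 := htr 1 H.one_mem
    have ta := htr a ha
    have tb := htr b hb
    have tab := htr (a * b) (H.mul_mem ha hb)
    have tba := htr (b * a) (H.mul_mem hb ha)
    rw [one_mul] at t1
    simp only [map_mul, Units.val_mul] at ta tb tab tba ⊢
    exact comm_of_trace_zero h2 _ _ _ hC t1 ta tb tab tba
  refine ⟨fun a b ha hb _ _ => hcomm a b ha hb, fun P Q => ?_⟩
  have : Fact p.Prime := ⟨hp⟩
  obtain ⟨g, hg⟩ := MulAction.exists_smul_eq H P Q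
  rw [← hg, eq_comm, Sylow.smul_eq_iff_mem_normalizer]
  have hn : (P : Subgroup H).Normal := ⟨fun n hn g => by
    have : g * n = n * g := Subtype.ext (hcomm g n g.2 n.2)
    rwa [this, mul_inv_cancel_right]⟩
  have ht : g ∈ Subgroup.normalizer ((P : Subgroup H) : Set H) := by
    rw [Subgroup.normalizer_eq_top]
    trivial
  exact ht
end

section
/- Let k ≥ 1 be an integer. Define functions h_m : ℝ → ℝ (m ≥ 0) by h₀(x) = x^(k/2) · exp(−2πx) for x > 0, and recursively h_{m+1}(x) = (−8π)^{−1} · (2x · h_m′(x) + (k + 2m − 4πx) · h_m(x)). Then for every m ≥ 0, ∫₀^∞ h_m(x)² · x^{−1} dx = Γ(k+m) · Γ(m+1) / (4π)^{k+2m}. -/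
open Real MeasureTheory

open Polynomial in
/-- Laguerre-type polynomials of the raising recursion (with `k = j + 1`). -/
noncomputable def torQ (j : ℕ) : ℕ → Polynomial ℝ
  | 0 => 1
  | m + 1 => (X - C ((j : ℝ) + 1 + m)) * torQ j m - X * derivative (torQ j m)

lemma tor_monomial (j n : ℕ) :
    IntegrableOn (fun t : ℝ => t ^ n * (t ^ j * Real.exp (-t))) (Set.Ioi 0) ∧
    ∫ t in Set.Ioi (0 : ℝ), t ^ n * (t ^ j * Real.exp (-t)) = ((j + n).factorial : ℝ) := by
  have hp : (0 : ℝ) < ((j + n : ℕ) : ℝ) + 1 := by positivity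
  have e : (fun t : ℝ => t ^ n * (t ^ j * Real.exp (-t))) =
      fun t : ℝ => Real.exp (-t) * t ^ (((j + n : ℕ) : ℝ) + 1 - 1) := by
    funext t
    rw [add_sub_cancel_right, Real.rpow_natCast]
    ring
  rw [e]
  exact ⟨Real.GammaIntegral_convergent hp, by
    rw [← Real.Gamma_eq_integral hp, Real.Gamma_nat_eq_factorial]⟩

lemma tor_integrable (j : ℕ) (p : Polynomial ℝ) :
    IntegrableOn (fun t : ℝ => p.eval t * (t ^ j * Real.exp (-t))) (Set.Ioi 0) := by
  induction p using Polynomial.induction_on' with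
  | add p q hp hq =>
    refine (hp.add hq).congr_fun (fun t _ => ?_) measurableSet_Ioi
    simp [add_mul]
  | monomial n a =>
    have h1 : IntegrableOn (fun t : ℝ => a * (t ^ n * (t ^ j * Real.exp (-t)))) (Set.Ioi 0) :=
      (tor_monomial j n).1.const_mul a
    refine h1.congr_fun (fun t _ => ?_) measurableSet_Ioi
    simp [mul_assoc]

/-- The moment functional. -/
noncomputable def torL (j : ℕ) : Polynomial ℝ →ₗ[ℝ] ℝ where
  toFun p := ∫ t in Set.Ioi (0 : ℝ), p.eval t * (t ^ j * Real.exp (-t))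
  map_add' p q := by
    rw [← integral_add (tor_integrable j p) (tor_integrable j q)]
    simp [add_mul]
  map_smul' c p := by
    simp only [Polynomial.eval_smul, smul_eq_mul, RingHom.id_apply, mul_assoc]
    rw [integral_const_mul]

lemma torL_monomial (j n : ℕ) (a : ℝ) :
    torL j (Polynomial.monomial n a) = a * ((j + n).factorial : ℝ) := by
  rw [← (tor_monomial j n).2, ← integral_const_mul]
  simp [torL, mul_assoc]

open Polynomial in
lemma torL_parts (j : ℕ) (p : Polynomial ℝ) :
    torL j (X * derivative p) = torL j (X * p) - ((j : ℝ) + 1) * torL j p := by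
  induction p using Polynomial.induction_on' with
  | add p q hp hq => simp only [mul_add, map_add, hp, hq]; ring
  | monomial n a =>
    rw [derivative_monomial, X_mul_monomial, X_mul_monomial, torL_monomial, torL_monomial,
      torL_monomial]
    rcases n with _ | n
    · simp [Nat.factorial_succ]; ring
    · have : j + (n + 1 + 1) = (j + (n + 1)) + 1 := by ring
      rw [this, Nat.factorial_succ (j + (n + 1))]
      push_cast
      ring

open Polynomial in
lemma torQ_ode (j m : ℕ) :
    X * derivative (derivative (torQ j m)) + (C ((j : ℝ) + 1) - X) * derivative (torQ j m)
      + C (m : ℝ) * torQ j m = 0 ∧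
    derivative (torQ j (m + 1)) = C ((m : ℝ) + 1) * (torQ j m - derivative (torQ j m)) := by
  have key : ∀ m, X * derivative (derivative (torQ j m))
      + (C ((j : ℝ) + 1) - X) * derivative (torQ j m) + C (m : ℝ) * torQ j m = 0 →
      derivative (torQ j (m + 1)) = C ((m : ℝ) + 1) * (torQ j m - derivative (torQ j m)) := by
    intro m h
    simp only [torQ, derivative_sub, derivative_mul, derivative_X, derivative_C, map_add, map_one,
      derivative_one]
      at h ⊢
    linear_combination -h
  have ode : X * derivative (derivative (torQ j m))
      + (C ((j : ℝ) + 1) - X) * derivative (torQ j m) + C (m : ℝ) * torQ j m = 0 := by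
    induction m with
    | zero => simp [torQ]
    | succ m ih =>
      rw [key m ih]
      simp only [torQ, derivative_sub, derivative_mul, derivative_C, map_add, map_one, derivative_one,
        Nat.cast_add, Nat.cast_one] at ih ⊢
      linear_combination -(C (m : ℝ) + 1) * ih
  exact ⟨ode, key m ode⟩

open Polynomial in
lemma torQ_lower (j m : ℕ) :
    X * derivative (torQ j (m + 1)) =
      C ((m : ℝ) + 1) * (torQ j (m + 1) + C ((j : ℝ) + 1 + m) * torQ j m) := by
  rw [(torQ_ode j m).2]
  simp only [torQ]
  ring

open Polynomial in
lemma torL_adj (j m : ℕ) (r : Polynomial ℝ) :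
    torL j (torQ j (m + 1) * r) = torL j (torQ j m * (X * derivative r - C (m : ℝ) * r)) := by
  have h := torL_parts j (torQ j m * r)
  have h2 : ((j : ℝ) + 1) * torL j (torQ j m * r) = torL j (C ((j : ℝ) + 1) * (torQ j m * r)) := by
    rw [← smul_eq_C_mul, map_smul, smul_eq_mul]
  rw [h2, ← map_sub] at h
  rw [← sub_eq_zero, ← map_sub] at h ⊢
  rw [← neg_eq_zero, ← map_neg, ← h]
  congr 1
  simp only [torQ, derivative_mul, map_add]
  ring

open Polynomial in
lemma torL_orth (j m : ℕ) : torL j (torQ j (m + 1) * torQ j m) = 0 := by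
  induction m with
  | zero => rw [torL_adj]; simp [torQ]
  | succ m ih =>
    rw [torL_adj, torQ_lower]
    have : torQ j (m + 1) * (C ((m : ℝ) + 1) * (torQ j (m + 1) + C ((j : ℝ) + 1 + m) * torQ j m)
        - C ((m + 1 : ℕ) : ℝ) * torQ j (m + 1)) =
        (((m : ℝ) + 1) * ((j : ℝ) + 1 + m)) • (torQ j (m + 1) * torQ j m) := by
      rw [smul_eq_C_mul, C_mul]; push_cast; ring
    rw [this, map_smul, ih, smul_zero]

open Polynomial in
lemma torL_sq (j m : ℕ) :
    torL j (torQ j m ^ 2) = ((j + m).factorial : ℝ) * (m.factorial : ℝ) := by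
  induction m with
  | zero =>
    have := torL_monomial j 0 1
    simpa [torQ] using this
  | succ m ih =>
    rw [sq, torL_adj, torQ_lower]
    have : torQ j m * (C ((m : ℝ) + 1) * (torQ j (m + 1) + C ((j : ℝ) + 1 + m) * torQ j m)
        - C (m : ℝ) * torQ j (m + 1)) =
        torQ j (m + 1) * torQ j m + (((m : ℝ) + 1) * ((j : ℝ) + 1 + m)) • (torQ j m ^ 2) := by
      rw [smul_eq_C_mul, C_mul, C_add (a := (m : ℝ)), C_1]; ring
    rw [this, map_add, map_smul, ih, torL_orth, ← add_assoc, Nat.factorial_succ,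
      Nat.factorial_succ]
    push_cast
    simp
    ring

/-- Archimedean local toric period integral (analytic content of Proposition 4.1):
with `h₀(x) = x^(k/2) e^{-2πx}` and `h_{m+1} = (-8π)⁻¹ (2x h_m' + (k + 2m - 4πx) h_m)`,
one has `∫₀^∞ h_m(x)² dx/x = Γ(k+m) Γ(m+1) / (4π)^{k+2m}`. -/
theorem archimedean_toric_integral
    (k : ℕ) (hk : 1 ≤ k) (h : ℕ → ℝ → ℝ)
    (h0 : ∀ x : ℝ, 0 < x → h 0 x = x ^ ((k : ℝ) / 2) * Real.exp (-(2 * π * x)))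
    (hrec : ∀ m : ℕ, ∀ x : ℝ, 0 < x →
      h (m + 1) x = (-(8 * π))⁻¹ *
        (2 * x * deriv (h m) x + ((k : ℝ) + 2 * (m : ℝ) - 4 * π * x) * h m x)) :
    ∀ m : ℕ, ∫ x in Set.Ioi (0 : ℝ), (h m x) ^ 2 / x =
      Real.Gamma ((k : ℝ) + (m : ℝ)) * Real.Gamma ((m : ℝ) + 1) / (4 * π) ^ (k + 2 * m) := by
  obtain ⟨j, rfl⟩ : ∃ j, k = j + 1 := ⟨k - 1, by omega⟩
  have hpi : (0 : ℝ) < 4 * π := by positivity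
  have hpi0 : π ≠ 0 := Real.pi_ne_zero
  have form : ∀ m : ℕ, ∀ x : ℝ, 0 < x → h m x = ((4 * π) ^ m)⁻¹ * ((torQ j m).eval (4 * π * x) *
      (x ^ (((j + 1 : ℕ) : ℝ) / 2) * Real.exp (-(2 * π * x)))) := by
    intro m
    induction m with
    | zero => intro x hx; rw [h0 x hx]; simp [torQ]
    | succ m ih =>
      intro x hx
      have hd : HasDerivAt (h m) (((4 * π) ^ m)⁻¹ *
          (((torQ j m).derivative.eval (4 * π * x) * (4 * π)) *
            (x ^ (((j + 1 : ℕ) : ℝ) / 2) * Real.exp (-(2 * π * x))) +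
          (torQ j m).eval (4 * π * x) *
            (((((j + 1 : ℕ) : ℝ) / 2) * x ^ (((j + 1 : ℕ) : ℝ) / 2 - 1)) * Real.exp (-(2 * π * x)) +
              x ^ (((j + 1 : ℕ) : ℝ) / 2) * (Real.exp (-(2 * π * x)) * (-(2 * π)))))) x := by
        have e : h m =ᶠ[nhds x] fun x => ((4 * π) ^ m)⁻¹ * ((torQ j m).eval (4 * π * x) *
            (x ^ (((j + 1 : ℕ) : ℝ) / 2) * Real.exp (-(2 * π * x)))) := by
          filter_upwards [lt_mem_nhds hx] with y hy using ih y hy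
        refine HasDerivAt.congr_of_eventuallyEq ?_ e
        have l1 : HasDerivAt (fun x : ℝ => 4 * π * x) (4 * π) x := by
          simpa using (hasDerivAt_id x).const_mul (4 * π)
        have l2 : HasDerivAt (fun x : ℝ => -(2 * π * x)) (-(2 * π)) x := by
          simpa using ((hasDerivAt_id x).const_mul (-(2 * π)))
        have l3 := HasDerivAt.comp x ((torQ j m).hasDerivAt (4 * π * x)) l1
        have l4 := Real.hasDerivAt_rpow_const (x := x) (p := ((j + 1 : ℕ) : ℝ) / 2) (Or.inl hx.ne')
        exact (l3.mul (l4.mul l2.exp)).const_mul _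
      rw [hrec m x hx, hd.deriv, ih x hx, Real.rpow_sub_one hx.ne']
      simp only [torQ, Polynomial.eval_sub, Polynomial.eval_mul, Polynomial.eval_X,
        Polynomial.eval_C]
      generalize (torQ j m).eval (4 * π * x) = A
      generalize (torQ j m).derivative.eval (4 * π * x) = B
      generalize x ^ (((j + 1 : ℕ) : ℝ) / 2) = Y
      generalize Real.exp (-(2 * π * x)) = E
      push_cast
      have := hx.ne'
      rw [pow_succ]
      field_simp
      ring
  intro m
  have key : ∀ x ∈ Set.Ioi (0 : ℝ), (h m x) ^ 2 / x = ((4 * π) ^ (j + 2 * m))⁻¹ *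
      (fun t : ℝ => (torQ j m ^ 2).eval t * (t ^ j * Real.exp (-t))) (4 * π * x) := by
    intro x hx
    have hx' : (0 : ℝ) < x := hx
    have e1 : (x ^ (((j + 1 : ℕ) : ℝ) / 2)) ^ 2 = x ^ (j + 1) := by
      rw [← Real.rpow_natCast, ← Real.rpow_mul hx'.le, ← Real.rpow_natCast]
      congr 1
      push_cast
      ring
    have e2 : Real.exp (-(4 * π * x)) = Real.exp (-(2 * π * x)) ^ 2 := by
      rw [← Real.exp_nat_mul]; congr 1; push_cast; ring
    rw [form m x hx']
    simp only [Polynomial.eval_pow]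
    rw [e2, mul_pow (((4 * π) ^ m)⁻¹), mul_pow (Polynomial.eval _ _),
      mul_pow (x ^ (((j + 1 : ℕ) : ℝ) / 2)), e1, mul_pow (4 * π) x j, pow_add (4 * π), pow_mul']
    have := hpi.ne'
    have := hx'.ne'
    generalize (torQ j m).eval (4 * π * x) = A
    generalize Real.exp (-(2 * π * x)) = E
    generalize 4 * π = c at *
    field_simp
    ring
  rw [setIntegral_congr_fun measurableSet_Ioi key, integral_const_mul,
    integral_comp_mul_left_Ioi
      (fun t : ℝ => (torQ j m ^ 2).eval t * (t ^ j * Real.exp (-t))) 0 hpi, mul_zero]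
  have := torL_sq j m
  simp only [torL, LinearMap.coe_mk, AddHom.coe_mk] at this
  rw [this, Real.Gamma_nat_eq_factorial]
  have g : ((j + 1 : ℕ) : ℝ) + (m : ℝ) = ((j + m : ℕ) : ℝ) + 1 := by push_cast; ring
  rw [g, Real.Gamma_nat_eq_factorial, smul_eq_mul]
  have e : j + 1 + 2 * m = (j + 2 * m) + 1 := by ring
  rw [e, pow_succ, div_eq_mul_inv, mul_inv]
  ring
end
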